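/- Let G be a finite complex reflection group. If ℓ(g) = codim(g) for all codimension atoms g in G, then ℓ(g) = codim(g) for all g in G. -/

import Mathlib

open Module

noncomputable section

variable {V : Type*} [AddCommGroup V] [Module ℂ V] [FiniteDimensional ℂ V]

/-- The fixed point space of a linear automorphism. -/
def fixedSpace (g : V ≃ₗ[ℂ] V) : Submodule ℂ V :=
  LinearMap.ker ((g : V →ₗ[ℂ] V) - LinearMap.id)

/-- codim(g) = dim V - dim V^g. -/
def codim (g : V ≃ₗ[ℂ] V) : ℕ :=
  finrank ℂ V - finrank ℂ (fixedSpace g)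

/-- A reflection: a nonidentity element fixing a hyperplane pointwise. -/
def IsReflection (g : V ≃ₗ[ℂ] V) : Prop :=
  g ≠ 1 ∧ finrank ℂ (fixedSpace g) + 1 = finrank ℂ V

/-- Reflection length: minimal number of reflections of `G` whose product is `g`. -/
def reflLength (G : Subgroup (V ≃ₗ[ℂ] V)) (g : G) : ℕ :=
  sInf {k | ∃ l : List G, (∀ s ∈ l, IsReflection (s : V ≃ₗ[ℂ] V)) ∧ l.length = k ∧ l.prod = g}

/-- `G` is generated by its reflections. -/
def IsGeneratedByReflections (G : Subgroup (V ≃ₗ[ℂ] V)) : Prop :=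
  ∀ g : G, ∃ l : List G, (∀ s ∈ l, IsReflection (s : V ≃ₗ[ℂ] V)) ∧ l.prod = g

/-- The codimension order: a ≤⊥ c iff codim(a) + codim(a⁻¹c) = codim(c). -/
def codimLe (G : Subgroup (V ≃ₗ[ℂ] V)) (a c : G) : Prop :=
  codim (a : V ≃ₗ[ℂ] V) + codim ((a⁻¹ * c : G) : V ≃ₗ[ℂ] V) = codim (c : V ≃ₗ[ℂ] V)

/-- An atom of the codimension order: a minimal nonidentity element. -/
def IsCodimAtom (G : Subgroup (V ≃ₗ[ℂ] V)) (g : G) : Prop :=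
  g ≠ 1 ∧ ∀ h : G, h ≠ 1 → h ≠ g → ¬ codimLe G h g

theorem codim_eq_zero_imp (g : V ≃ₗ[ℂ] V) (h : codim g = 0) : g = 1 := by
  have h1 : finrank ℂ (fixedSpace g) ≤ finrank ℂ V := Submodule.finrank_le _
  have h2 : fixedSpace g = ⊤ := by
    apply Submodule.eq_top_of_finrank_eq
    unfold codim at h
    omega
  ext v
  have h3 : v ∈ fixedSpace g := by rw [h2]; trivial
  simpa [fixedSpace, sub_eq_zero] using h3

theorem codim_one_eq : codim (1 : V ≃ₗ[ℂ] V) = 0 := by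
  have h2 : fixedSpace (1 : V ≃ₗ[ℂ] V) = ⊤ := by
    rw [eq_top_iff]
    intro v _
    simp [fixedSpace]
  unfold codim
  rw [h2, finrank_top]
  simp

theorem codim_mul_le (a b : V ≃ₗ[ℂ] V) : codim (a * b) ≤ codim a + codim b := by
  have h1 : finrank ℂ (fixedSpace a) ≤ finrank ℂ V := Submodule.finrank_le _
  have h2 : finrank ℂ (fixedSpace b) ≤ finrank ℂ V := Submodule.finrank_le _
  have h3 := Submodule.finrank_sup_add_finrank_inf_eq (fixedSpace a) (fixedSpace b)
  have h4 : finrank ℂ (fixedSpace a ⊔ fixedSpace b : Submodule ℂ V) ≤ finrank ℂ V :=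
    Submodule.finrank_le _
  have h5 : fixedSpace a ⊓ fixedSpace b ≤ fixedSpace (a * b) := by
    rintro v ⟨ha, hb⟩
    have ha' : a v = v := by simpa [fixedSpace, sub_eq_zero] using ha
    have hb' : b v = v := by simpa [fixedSpace, sub_eq_zero] using hb
    simp [fixedSpace, sub_eq_zero, ha', hb']
  have h6 := Submodule.finrank_mono h5
  unfold codim
  omega

theorem codim_prod_le (G : Subgroup (V ≃ₗ[ℂ] V)) (l : List G)
    (hl : ∀ s ∈ l, IsReflection (s : V ≃ₗ[ℂ] V)) :
    codim ((l.prod : G) : V ≃ₗ[ℂ] V) ≤ l.length := by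
  induction l with
  | nil => simp [codim_one_eq]
  | cons s l ih =>
    have h1 := ih (fun t ht => hl t (List.mem_cons_of_mem _ ht))
    have h2 := (hl s List.mem_cons_self).2
    have h3 : codim (s : V ≃ₗ[ℂ] V) = 1 := by unfold codim; omega
    have h4 := codim_mul_le (s : V ≃ₗ[ℂ] V) ((l.prod : G) : V ≃ₗ[ℂ] V)
    rw [List.prod_cons, List.length_cons, Subgroup.coe_mul]
    omega

theorem exists_reflLength (G : Subgroup (V ≃ₗ[ℂ] V)) (hG : IsGeneratedByReflections G) (g : G) :
    ∃ l : List G, (∀ s ∈ l, IsReflection (s : V ≃ₗ[ℂ] V)) ∧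
      l.length = reflLength G g ∧ l.prod = g := by
  obtain ⟨l, hl, hp⟩ := hG g
  exact Nat.sInf_mem (s := {k | ∃ l : List G, (∀ s ∈ l, IsReflection (s : V ≃ₗ[ℂ] V)) ∧
    l.length = k ∧ l.prod = g}) ⟨l.length, l, hl, rfl, hp⟩

theorem reflLength_le (G : Subgroup (V ≃ₗ[ℂ] V)) (l : List G)
    (hl : ∀ s ∈ l, IsReflection (s : V ≃ₗ[ℂ] V)) : reflLength G l.prod ≤ l.length :=
  Nat.sInf_le ⟨l, hl, rfl, rfl⟩

theorem length_eq_codim_of_atoms (G : Subgroup (V ≃ₗ[ℂ] V)) [Finite G]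
    (hG : IsGeneratedByReflections G)
    (hatoms : ∀ g : G, IsCodimAtom G g → reflLength G g = codim (g : V ≃ₗ[ℂ] V)) :
    ∀ g : G, reflLength G g = codim (g : V ≃ₗ[ℂ] V) := by
  intro g
  induction hn : codim (g : V ≃ₗ[ℂ] V) using Nat.strong_induction_on generalizing g with
  | _ n ih =>
  by_cases hat : IsCodimAtom G g
  · rw [hatoms g hat, hn]
  by_cases h1 : g = 1
  · subst h1
    have := reflLength_le G [] (by simp)
    have h0 : codim ((1 : G) : V ≃ₗ[ℂ] V) = 0 := codim_one_eq
    simp only [List.prod_nil, List.length_nil] at this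
    omega
  obtain ⟨h, hh1, hhg, hle⟩ : ∃ h : G, h ≠ 1 ∧ h ≠ g ∧ codimLe G h g := by
    by_contra hcon
    push Not at hcon
    exact hat ⟨h1, hcon⟩
  unfold codimLe at hle
  have hc1 : codim (h : V ≃ₗ[ℂ] V) ≠ 0 := fun h0 =>
    hh1 (Subtype.ext (codim_eq_zero_imp _ h0))
  have hc2 : codim ((h⁻¹ * g : G) : V ≃ₗ[ℂ] V) ≠ 0 := fun h0 =>
    hhg (inv_mul_eq_one.mp (Subtype.ext (codim_eq_zero_imp _ h0)))
  have i1 := ih _ (by omega) h rfl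
  have i2 := ih _ (by omega) (h⁻¹ * g) rfl
  obtain ⟨l1, hl1, e1, p1⟩ := exists_reflLength G hG h
  obtain ⟨l2, hl2, e2, p2⟩ := exists_reflLength G hG (h⁻¹ * g)
  have hub := reflLength_le G (l1 ++ l2) (by
    intro s hs
    rcases List.mem_append.mp hs with hs | hs
    · exact hl1 s hs
    · exact hl2 s hs)
  rw [List.prod_append, p1, p2, mul_inv_cancel_left, List.length_append] at hub
  obtain ⟨l, hl, e, p⟩ := exists_reflLength G hG g
  have hlb := codim_prod_le G l hl
  rw [p] at hlb
  omega
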